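/- Let $\Omega = \{x = (x_1,x_2) \in \mathbb{R}^2 : |x_1| = |x_2| > 0\}$, and for $x \in \Omega$ let $\mathbb{P}_x$ assign mass $\tfrac{1}{4}$ to each of $(x_1,x_2)$, $(-x_1,x_2)$, $(x_1,-x_2)$, $(-x_1,-x_2)$. Let $R_1(x) = (x_1,-x_2)$, $A_{1x} = \{x, R_1(x)\}$, $R_2(x) = (-x_1,x_2)$, $A_{2x} = \{x, R_2(x)\}$, let $\mathcal{G}_i$ be the $\sigma$-field generated by $\{A_{ix} : x \in \Omega\}$ ($i=1,2$), let $\mathcal{G} = \sigma(\mathcal{G}_1 \cup \mathcal{G}_2)$, let $D = \{x \in \Omega : x_1 = x_2\}$, and let $\mathcal{F} = \sigma(\mathcal{G} \cup \{D\})$. Then with respect to the family $\{\mathbb{P}_x\}_{x \in \Omega}$ on $(\Omega,\mathcal{F})$, the sub-$\sigma$-field $\mathcal{G} = \sigma(\mathcal{G}_1 \cup \mathcal{G}_2)$ is not sufficient: there is no $\mathcal{G}$-measurable function $g$ with $\mathbb{P}_x(D \cap G) = \mathbb{E}_x[g \mathbf{1}_G]$ for all $G \in \mathcal{G}$ and all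 $x \in \Omega$. -/

import Mathlib

open MeasureTheory
open scoped ENNReal

/-- The sample space `Ω = {x ∈ ℝ² : |x₁| = |x₂| > 0}`. -/
def Om : Type := {p : ℝ × ℝ // |p.1| = |p.2| ∧ p.1 ≠ 0}

/-- Reflection in the first coordinate axis: `R₁(x₁, x₂) = (x₁, -x₂)`. -/
def R1 (x : Om) : Om :=
  ⟨(x.1.1, -x.1.2), by simpa [abs_neg] using x.2⟩

/-- Reflection in the second coordinate axis: `R₂(x₁, x₂) = (-x₁, x₂)`. -/
def R2 (x : Om) : Om :=
  ⟨(-x.1.1, x.1.2), by simpa [abs_neg, neg_eq_zero] using x.2⟩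

/-- `G₁` is generated by the pair sets `A₁ₓ = {x, R₁ x}`. -/
def G1 : MeasurableSpace Om :=
  MeasurableSpace.generateFrom {A : Set Om | ∃ x : Om, A = {x, R1 x}}

/-- `G₂` is generated by the pair sets `A₂ₓ = {x, R₂ x}`. -/
def G2 : MeasurableSpace Om :=
  MeasurableSpace.generateFrom {A : Set Om | ∃ x : Om, A = {x, R2 x}}

/-- `G = σ(G₁ ∪ G₂)`. -/
def Gu : MeasurableSpace Om := G1 ⊔ G2

/-- The diagonal `D = {x ∈ Ω : x₁ = x₂}`. -/
def D : Set Om := {x : Om | x.1.1 = x.1.2}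

/-- `F = σ(G ∪ {D})`. -/
def F : MeasurableSpace Om := Gu ⊔ MeasurableSpace.generateFrom {D}

/-- `P x` puts mass `1/4` on each of `(x₁,x₂)`, `(-x₁,x₂)`, `(x₁,-x₂)`, `(-x₁,-x₂)`. -/
noncomputable def P (x : Om) : @Measure Om F :=
  (4 : ℝ≥0∞)⁻¹ • (@Measure.dirac Om F x + @Measure.dirac Om F (R2 x) +
    @Measure.dirac Om F (R1 x) + @Measure.dirac Om F (R1 (R2 x)))

/-- The σ-field of countable and co-countable sets. -/
@[reducible] def countableCocountable (α : Type*) : MeasurableSpace α where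
  MeasurableSet' s := s.Countable ∨ sᶜ.Countable
  measurableSet_empty := Or.inl Set.countable_empty
  measurableSet_compl s h := by simpa [or_comm] using h
  measurableSet_iUnion f h := by
    by_cases hf : ∀ i, (f i).Countable
    · exact Or.inl (Set.countable_iUnion hf)
    · obtain ⟨i, hi⟩ := not_forall.mp hf
      exact Or.inr (((h i).resolve_left hi).mono
        (Set.compl_subset_compl.mpr (Set.subset_iUnion f i)))

lemma Gu_le_countableCocountable : Gu ≤ countableCocountable Om := by
  refine sup_le (MeasurableSpace.generateFrom_le ?_) (MeasurableSpace.generateFrom_le ?_) <;>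
  · rintro _ ⟨x, rfl⟩
    exact Or.inl (Set.toFinite _).countable

lemma R1_ne_R2 (x : Om) : R1 x ≠ R2 x := fun h => by
  have h1 : x.1.1 = -x.1.1 := congrArg (fun y : Om => y.1.1) h
  exact x.2.2 (self_eq_neg.mp h1)

lemma measurableSet_singleton_Gu (x : Om) : MeasurableSet[Gu] {x} := by
  have h : ({x} : Set Om) = {x, R1 x} ∩ {x, R2 x} := by
    ext y
    simp only [Set.mem_singleton_iff, Set.mem_inter_iff, Set.mem_insert_iff]
    refine ⟨fun h => ⟨Or.inl h, Or.inl h⟩, ?_⟩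
    rintro ⟨h | h, h' | h'⟩
    · exact h
    · exact h
    · exact h'
    · exact absurd (h.symm.trans h') (R1_ne_R2 x)
  rw [h]
  exact @MeasurableSet.inter Om Gu _ _
    ((le_sup_left : G1 ≤ Gu) _ (MeasurableSpace.measurableSet_generateFrom ⟨x, rfl⟩))
    ((le_sup_right : G2 ≤ Gu) _ (MeasurableSpace.measurableSet_generateFrom ⟨x, rfl⟩))

lemma not_countable_Ioi_zero : ¬ (Set.Ioi (0 : ℝ)).Countable := fun h => by
  have := Cardinal.le_aleph0_iff_set_countable.mpr h
  rw [Cardinal.mk_Ioi_real] at this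
  exact absurd this (not_le.mpr Cardinal.aleph0_lt_continuum)

lemma not_countable_of_forall_pos_exists {s : Set Om} (f : Om → ℝ)
    (h : ∀ t : ℝ, 0 < t → ∃ x ∈ s, f x = t) : ¬ s.Countable := fun hs =>
  not_countable_Ioi_zero ((hs.image f).mono fun t ht => h t ht)

lemma D_not_measurableSet_Gu : ¬ MeasurableSet[Gu] D := fun h => by
  rcases Gu_le_countableCocountable D h with h | h
  · exact not_countable_of_forall_pos_exists (fun x => x.1.1)
      (fun t ht => ⟨⟨(t, t), rfl, ht.ne'⟩, rfl, rfl⟩) h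
  · refine not_countable_of_forall_pos_exists (fun x => x.1.1)
      (fun t ht => ⟨⟨(t, -t), (abs_neg t).symm, ht.ne'⟩, fun h' => ?_, rfl⟩) h
    exact ht.ne' (self_eq_neg.mp h')

lemma isProbabilityMeasure_P (x : Om) : IsProbabilityMeasure (P x) := by
  let := F
  refine ⟨?_⟩
  simp only [P, Measure.smul_apply, Measure.add_apply, measure_univ, smul_eq_mul]
  norm_num
  exact ENNReal.inv_mul_cancel (by norm_num) (by norm_num)

lemma P_singleton_ne_zero (x : Om) : P x {x} ≠ 0 := by
  let := F
  simp [P]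

/-- For the family `{P x}` on `(Ω, F)`, the σ-field `G = σ(G₁ ∪ G₂)` is not sufficient:
there is no `G`-measurable `g` with `P x (D ∩ s) = E_x[g 1_s]` for all `G`-measurable
`s` and all `x`. -/
theorem sup_not_sufficient :
    (∀ x : Om, IsProbabilityMeasure (P x)) ∧
      ¬ ∃ g : Om → ℝ, Measurable[Gu] g ∧
        ∀ (x : Om) (s : Set Om), MeasurableSet[Gu] s →
          ((P x) (D ∩ s)).toReal = ∫ ω in s, g ω ∂(P x) := by
  refine ⟨isProbabilityMeasure_P, ?_⟩
  rintro ⟨g, hg, h⟩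
  let := F
  have hF : ∀ y : Om, MeasurableSet {y} := fun y =>
    (le_sup_left : Gu ≤ F) _ (measurableSet_singleton_Gu y)
  have : MeasurableSingletonClass Om := ⟨hF⟩
  have hD : D = g ⁻¹' {0}ᶜ := by
    ext x
    have := isProbabilityMeasure_P x
    have hx := h x {x} (measurableSet_singleton_Gu x)
    have h0 : (P x).real {x} ≠ 0 :=
      ENNReal.toReal_ne_zero.mpr ⟨P_singleton_ne_zero x, measure_ne_top _ _⟩
    rw [integral_singleton, smul_eq_mul] at hx
    simp only [Set.mem_preimage, Set.mem_compl_iff, Set.mem_singleton_iff]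
    by_cases hxD : x ∈ D
    · rw [Set.inter_eq_right.mpr (Set.singleton_subset_iff.mpr hxD)] at hx
      refine iff_of_true hxD fun hg0 => h0 ?_
      rw [hg0, mul_zero] at hx
      exact hx
    · rw [Set.inter_singleton_eq_empty.mpr hxD, measure_empty, ENNReal.toReal_zero] at hx
      exact iff_of_false hxD fun hn => hn ((mul_eq_zero.mp hx.symm).resolve_left h0)
  exact D_not_measurableSet_Gu (hD ▸ hg (measurableSet_singleton 0).compl)
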